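/- arXiv:2603.02356 — 11 statements merged into one kernel-verified Lean document; each statement's English description precedes it below -/
import Mathlib

section
/- Let S < 0 and let λ : [S,∞) → ℝ be continuous with λ(u) ≥ c for all u ≥ S, for some constant c > 0. Define F(b) := -∫_b^0 y·λ(y)·exp(-∫_b^y λ(u) du) dy + ∫_0^∞ y·λ(y)·exp(-∫_b^y λ(u) du) dy for b ∈ [S,0]. If b* ∈ [S,0) satisfies ∫_{b*}^0 exp(∫_y^0 λ(u) du) dy = ∫_0^∞ exp(-∫_0^y λ(u) du) dy, then F(b*) ≤ F(b) for all b ∈ [S,0]. -/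
open MeasureTheory Set

/-- The survival function `y ↦ exp (-∫₀ʸ l)` of an intensity `l`. -/
noncomputable def survival (l : ℝ → ℝ) (y : ℝ) : ℝ := Real.exp (-∫ u in (0 : ℝ)..y, l u)

lemma survival_pos (l : ℝ → ℝ) (y : ℝ) : 0 < survival l y := Real.exp_pos _

lemma hasDerivAt_survival {l : ℝ → ℝ} (hl : Continuous l) (y : ℝ) :
    HasDerivAt (survival l) (-(l y * survival l y)) y := by
  have h := (hl.integral_hasStrictDerivAt 0 y).hasDerivAt.neg.exp
  refine h.congr_deriv ?_
  simp only [survival, Pi.neg_apply]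
  ring

lemma continuous_survival {l : ℝ → ℝ} (hl : Continuous l) : Continuous (survival l) :=
  continuous_iff_continuousAt.2 fun y => (hasDerivAt_survival hl y).continuousAt

lemma antitone_survival {l : ℝ → ℝ} (hl : Continuous l) (h0 : ∀ u, 0 ≤ l u) :
    Antitone (survival l) := by
  refine antitone_of_hasDerivAt_nonpos (hasDerivAt_survival hl) fun y => ?_
  simpa using mul_nonneg (h0 y) (survival_pos l y).le

lemma exp_neg_integral_eq_survival_div {l : ℝ → ℝ} (hl : Continuous l) (b y : ℝ) :
    Real.exp (-∫ u in b..y, l u) = survival l y / survival l b := by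
  rw [survival, survival, ← Real.exp_sub,
    ← intervalIntegral.integral_add_adjacent_intervals
      (hl.intervalIntegrable 0 b) (hl.intervalIntegrable b y)]
  congr 1
  ring

lemma survival_le_exp {l : ℝ → ℝ} (hl : Continuous l) {c : ℝ} (hlb : ∀ u, c ≤ l u)
    {y : ℝ} (hy : 0 ≤ y) : survival l y ≤ Real.exp (-c * y) := by
  have h : ∫ _ in (0 : ℝ)..y, c ≤ ∫ u in (0 : ℝ)..y, l u :=
    intervalIntegral.integral_mono_on hy (by simp) (hl.intervalIntegrable 0 y) fun u _ => hlb u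
  refine Real.exp_le_exp.2 ?_
  simp only [intervalIntegral.integral_const, smul_eq_mul, sub_zero] at h
  linarith

lemma integrableOn_survival {l : ℝ → ℝ} (hl : Continuous l) {c : ℝ} (hc : 0 < c)
    (hlb : ∀ u, c ≤ l u) : IntegrableOn (survival l) (Ioi 0) := by
  refine (exp_neg_integrableOn_Ioi 0 hc).mono'
    (continuous_survival hl).aestronglyMeasurable.restrict ?_
  filter_upwards [ae_restrict_mem measurableSet_Ioi] with y hy
  rw [Real.norm_of_nonneg (survival_pos l y).le]
  exact survival_le_exp hl hlb (le_of_lt hy)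

lemma tendsto_mul_survival {l : ℝ → ℝ} (hl : Continuous l) {c : ℝ} (hc : 0 < c)
    (hlb : ∀ u, c ≤ l u) :
    Filter.Tendsto (fun y => y * survival l y) Filter.atTop (nhds 0) := by
  have h : Filter.Tendsto (fun y : ℝ => y * Real.exp (-c * y)) Filter.atTop (nhds 0) := by
    simpa using tendsto_rpow_mul_exp_neg_mul_atTop_nhds_zero 1 c hc
  refine tendsto_of_tendsto_of_tendsto_of_le_of_le' tendsto_const_nhds h ?_ ?_
  · filter_upwards [Filter.eventually_ge_atTop 0] with y hy
    exact mul_nonneg hy (survival_pos l y).le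
  · filter_upwards [Filter.eventually_ge_atTop 0] with y hy
    exact mul_le_mul_of_nonneg_left (survival_le_exp hl hlb hy) hy

lemma hasDerivAt_integral_survival_sub {l : ℝ → ℝ} (hl : Continuous l) (y : ℝ) :
    HasDerivAt (fun y => (∫ u in (0 : ℝ)..y, survival l u) - y * survival l y)
      (y * l y * survival l y) y := by
  have h := ((continuous_survival hl).integral_hasStrictDerivAt 0 y).hasDerivAt.sub
    ((hasDerivAt_id y).mul (hasDerivAt_survival hl y))
  refine h.congr_deriv ?_
  simp only [id]
  ring

lemma integral_mul_survival {l : ℝ → ℝ} (hl : Continuous l) (b : ℝ) :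
    ∫ y in b..(0 : ℝ), y * l y * survival l y =
      (∫ y in b..(0 : ℝ), survival l y) + b * survival l b := by
  have hcont := continuous_survival hl
  rw [intervalIntegral.integral_eq_sub_of_hasDerivAt
    (fun y _ => hasDerivAt_integral_survival_sub hl y)
    (Continuous.intervalIntegrable (by fun_prop) _ _),
    intervalIntegral.integral_symm b 0]
  simp [add_comm]

lemma integral_Ioi_mul_survival {l : ℝ → ℝ} (hl : Continuous l) {c : ℝ} (hc : 0 < c)
    (hlb : ∀ u, c ≤ l u) :
    ∫ y in Ioi (0 : ℝ), y * l y * survival l y = ∫ y in Ioi (0 : ℝ), survival l y := by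
  have htend := (intervalIntegral_tendsto_integral_Ioi 0 (integrableOn_survival hl hc hlb)
    Filter.tendsto_id).sub (tendsto_mul_survival hl hc hlb)
  have h := integral_Ioi_of_hasDerivAt_of_nonneg'
    (fun y _ => hasDerivAt_integral_survival_sub hl y)
    (fun y hy => mul_nonneg (mul_nonneg (le_of_lt hy) (hc.le.trans (hlb y)))
      (survival_pos l y).le) htend
  simpa using h

lemma expected_distance_eq {l : ℝ → ℝ} (hl : Continuous l) {c : ℝ} (hc : 0 < c)
    (hlb : ∀ u, c ≤ l u) (b : ℝ) :
    -(∫ y in b..(0 : ℝ), y * l y * Real.exp (-∫ u in b..y, l u)) +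
        ∫ y in Ioi (0 : ℝ), y * l y * Real.exp (-∫ u in b..y, l u) =
      ((∫ y in Ioi (0 : ℝ), survival l y) - ∫ y in b..(0 : ℝ), survival l y) / survival l b
        - b := by
  simp only [exp_neg_integral_eq_survival_div hl b, ← mul_div_assoc]
  rw [intervalIntegral.integral_div, integral_div, integral_mul_survival hl,
    integral_Ioi_mul_survival hl hc hlb]
  have := (survival_pos l b).ne'
  field_simp
  ring

lemma sub_mul_le_integral_of_antitone {f : ℝ → ℝ} (hf : Continuous f) (ha : Antitone f)
    (a b : ℝ) : (b - a) * f b ≤ ∫ y in a..b, f y := by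
  rcases le_total a b with h | h
  · have := intervalIntegral.integral_mono_on h (intervalIntegrable_const (c := f b) (μ := volume)) (hf.intervalIntegrable a b)
      fun y hy => ha hy.2
    simpa using this
  · have := intervalIntegral.integral_mono_on h (hf.intervalIntegrable b a)
      (intervalIntegrable_const (c := f b) (μ := volume)) fun y hy => ha hy.1
    rw [intervalIntegral.integral_const, smul_eq_mul] at this
    rw [intervalIntegral.integral_symm]
    linarith

theorem stmt_1 (S : ℝ) (hS : S < 0) (lam : ℝ → ℝ) (c : ℝ) (hc : 0 < c)
    (hcont : ContinuousOn lam (Set.Ici S)) (hlb : ∀ u ∈ Set.Ici S, c ≤ lam u)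
    (F : ℝ → ℝ)
    (hF : ∀ b ∈ Set.Icc S 0,
      F b = -(∫ y in b..(0 : ℝ), y * lam y * Real.exp (-∫ u in b..y, lam u)) +
        ∫ y in Set.Ioi (0 : ℝ), y * lam y * Real.exp (-∫ u in b..y, lam u))
    (bs : ℝ) (hbs : bs ∈ Set.Ico S 0)
    (heq : (∫ y in bs..(0 : ℝ), Real.exp (∫ u in y..(0 : ℝ), lam u)) =
      ∫ y in Set.Ioi (0 : ℝ), Real.exp (-∫ u in (0 : ℝ)..y, lam u)) :
    ∀ b ∈ Set.Icc S 0, F bs ≤ F b := by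
  obtain ⟨l, hl, hll, hlam⟩ : ∃ l : ℝ → ℝ, Continuous l ∧ (∀ u, c ≤ l u) ∧
      ∀ u, S ≤ u → lam u = l u :=
    ⟨fun u => lam (max S u),
      hcont.comp_continuous (by fun_prop) fun u => le_max_left S u,
      fun u => hlb _ (le_max_left S u), fun u hu => by simp [max_eq_right hu]⟩
  have hint : ∀ a b : ℝ, S ≤ a → S ≤ b → ∫ u in a..b, lam u = ∫ u in a..b, l u :=
    fun a b ha hb => intervalIntegral.integral_congr fun u hu =>
      hlam u ((le_min ha hb).trans hu.1)
  have hF' : ∀ b ∈ Icc S 0, F b =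
      ((∫ y in Ioi (0 : ℝ), survival l y) - ∫ y in b..(0 : ℝ), survival l y) / survival l b
        - b := by
    intro b hb
    rw [hF b hb, ← expected_distance_eq hl hc hll b]
    refine congrArg₂ (· + ·) (congrArg Neg.neg ?_) ?_
    · refine intervalIntegral.integral_congr fun y hy => ?_
      have hy' : S ≤ y := (le_min hb.1 hS.le).trans hy.1
      simp only [hlam y hy', hint b y hb.1 hy']
    · refine setIntegral_congr_fun measurableSet_Ioi fun y hy => ?_
      have hy' : S ≤ y := hS.le.trans (le_of_lt (mem_Ioi.1 hy))
      simp only [hlam y hy', hint b y hb.1 hy']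
  have heq' : ∫ y in bs..(0 : ℝ), survival l y = ∫ y in Ioi (0 : ℝ), survival l y := by
    convert heq using 1
    · refine intervalIntegral.integral_congr fun y hy => ?_
      have hy' : S ≤ y := (le_min hbs.1 hS.le).trans hy.1
      simp only [hint y 0 hy' hS.le, survival, intervalIntegral.integral_symm y 0, neg_neg]
    · refine setIntegral_congr_fun measurableSet_Ioi fun y hy => ?_
      simp only [hint 0 y hS.le (hS.le.trans (le_of_lt (mem_Ioi.1 hy))), survival]
  intro b hb
  have hE := continuous_survival hl
  rw [hF' b hb, hF' bs ⟨hbs.1, hbs.2.le⟩, ← heq', sub_self, zero_div,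
    ← intervalIntegral.integral_add_adjacent_intervals (hE.intervalIntegrable bs b)
      (hE.intervalIntegrable b 0), add_sub_cancel_right]
  have h := (le_div_iff₀ (survival_pos l b)).2 (sub_mul_le_integral_of_antitone hE
    (antitone_survival hl fun u => hc.le.trans (hll u)) bs b)
  linarith
end

section
/- Let S < 0 and let λ : [S,∞) → ℝ be continuous with λ(u) ≥ c for all u ≥ S, for some constant c > 0. Define F(b) := -∫_b^0 y·λ(y)·exp(-∫_b^y λ(u) du) dy + ∫_0^∞ y·λ(y)·exp(-∫_b^y λ(u) du) dy for b ∈ [S,0]. Then F is differentiable on (S,0) and its derivative satisfies F'(b) = λ(b)·(b + F(b)) for all b ∈ (S,0). -/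
open MeasureTheory Set

theorem stmt_2 (S : ℝ) (hS : S < 0) (lam : ℝ → ℝ) (c : ℝ) (hc : 0 < c)
    (hcont : ContinuousOn lam (Set.Ici S)) (hlb : ∀ u ∈ Set.Ici S, c ≤ lam u)
    (F : ℝ → ℝ)
    (hF : ∀ b ∈ Set.Icc S 0,
      F b = -(∫ y in b..(0 : ℝ), y * lam y * Real.exp (-∫ u in b..y, lam u)) +
        ∫ y in Set.Ioi (0 : ℝ), y * lam y * Real.exp (-∫ u in b..y, lam u)) :
    ∀ b ∈ Set.Ioo S 0, HasDerivAt F (lam b * (b + F b)) b := by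
  -- Extend `lam` continuously to the whole line.
  set L : ℝ → ℝ := fun u => lam (max S u) with hL
  have hLc : Continuous L :=
    hcont.comp_continuous (by fun_prop) fun u => le_max_left S u
  have hLe : ∀ u, S ≤ u → L u = lam u := fun u hu => by simp [hL, max_eq_right hu]
  set A : ℝ → ℝ := fun x => ∫ u in (0 : ℝ)..x, L u with hA
  have hAd : ∀ x, HasDerivAt A (L x) x := fun x => hLc.integral_hasStrictDerivAt 0 x |>.hasDerivAt
  have hAc : Continuous A := continuous_iff_continuousAt.2 fun x => (hAd x).continuousAt
  have hAsub : ∀ b y, S ≤ b → S ≤ y → ∫ u in b..y, lam u = A y - A b := by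
    intro b y hb hy
    rw [hA, intervalIntegral.integral_interval_sub_left (hLc.intervalIntegrable _ _)
      (hLc.intervalIntegrable _ _)]
    refine intervalIntegral.integral_congr fun u hu => (hLe u ?_).symm
    exact (le_min hb hy).trans hu.1
  set g : ℝ → ℝ := fun y => y * L y * Real.exp (-A y) with hg
  have hgc : Continuous g := by fun_prop
  have hint : ∀ b y, S ≤ b → S ≤ y →
      y * lam y * Real.exp (-∫ u in b..y, lam u) = Real.exp (A b) * g y := by
    intro b y hb hy
    rw [hAsub b y hb hy, neg_sub, sub_eq_add_neg, Real.exp_add, hg]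
    simp only [hLe y hy]
    ring
  set K : ℝ := ∫ y in Ioi (0 : ℝ), g y with hK
  -- The dependence on the threshold factors out of both integrals.
  have hFeq : ∀ b ∈ Icc S 0, F b = Real.exp (A b) * ((∫ y in (0 : ℝ)..b, g y) + K) := by
    intro b hb
    have h₁ : ∫ y in b..(0 : ℝ), y * lam y * Real.exp (-∫ u in b..y, lam u) =
        Real.exp (A b) * ∫ y in b..(0 : ℝ), g y := by
      rw [← intervalIntegral.integral_const_mul]
      refine intervalIntegral.integral_congr fun y hy => hint b y hb.1 ?_
      exact (le_min hb.1 hS.le).trans hy.1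
    have h₂ : ∫ y in Ioi (0 : ℝ), y * lam y * Real.exp (-∫ u in b..y, lam u) =
        Real.exp (A b) * K := by
      rw [hK, ← integral_const_mul]
      exact setIntegral_congr_fun measurableSet_Ioi fun y hy =>
        hint b y hb.1 (hS.le.trans (le_of_lt hy))
    rw [hF b hb, h₁, h₂, intervalIntegral.integral_symm 0 b]
    ring
  intro b hb
  have hd : HasDerivAt (fun x => Real.exp (A x) * ((∫ y in (0 : ℝ)..x, g y) + K))
      (Real.exp (A b) * L b * ((∫ y in (0 : ℝ)..b, g y) + K) + Real.exp (A b) * g b) b :=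
    (hAd b).exp.mul ((hgc.integral_hasStrictDerivAt 0 b).hasDerivAt.add_const K)
  have heq : F =ᶠ[nhds b] fun x => Real.exp (A x) * ((∫ y in (0 : ℝ)..x, g y) + K) :=
    Filter.eventuallyEq_of_mem (Ioo_mem_nhds hb.1 hb.2) fun x hx => hFeq x ⟨hx.1.le, hx.2.le⟩
  refine (hd.congr_of_eventuallyEq heq).congr_deriv ?_
  have hexp : Real.exp (A b) * Real.exp (-A b) = 1 := by rw [← Real.exp_add]; simp
  rw [hFeq b ⟨hb.1.le, hb.2.le⟩, ← hLe b hb.1.le]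
  simp only [hg]
  linear_combination (b * L b) * hexp
end

section
/- Let S < 0 and let λ : [S,∞) → ℝ be continuous with λ(u) ≥ c for all u ≥ S, for some constant c > 0. Define F(b) := -∫_b^0 y·λ(y)·exp(-∫_b^y λ(u) du) dy + ∫_0^∞ y·λ(y)·exp(-∫_b^y λ(u) du) dy for b ∈ [S,0]. Then for every b ∈ [S,0) the following equivalence holds: b + F(b) = 0 if and only if ∫_b^0 exp(∫_y^0 λ(u) du) dy = ∫_0^∞ exp(-∫_0^y λ(u) du) dy. (In other words, the optimality equation is equivalent to the indifference condition |b| = F(b).) -/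
open MeasureTheory Set

section SurvivalFunction

variable {lam : ℝ → ℝ} {b c : ℝ}

lemma hasDerivAt_exp_neg_integral (h : Continuous lam) (b y : ℝ) :
    HasDerivAt (fun y => Real.exp (-∫ u in b..y, lam u))
      (-(lam y * Real.exp (-∫ u in b..y, lam u))) y := by
  have h1 : HasDerivAt (fun y => ∫ u in b..y, lam u) (lam y) y :=
    intervalIntegral.integral_hasDerivAt_right (h.intervalIntegrable _ _)
      h.stronglyMeasurable.stronglyMeasurableAtFilter h.continuousAt
  exact h1.fun_neg.exp.congr_deriv (by ring)

lemma continuous_exp_neg_integral (h : Continuous lam) (b : ℝ) :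
    Continuous (fun y => Real.exp (-∫ u in b..y, lam u)) :=
  continuous_iff_continuousAt.2 fun y => (hasDerivAt_exp_neg_integral h b y).continuousAt

/-- An antiderivative of `y * lam y * exp (-∫ u in b..y, lam u)`, from integration by parts. -/
lemma hasDerivAt_parts (h : Continuous lam) (b y : ℝ) :
    HasDerivAt (fun y => (∫ z in (0 : ℝ)..y, Real.exp (-∫ u in b..z, lam u)) -
        y * Real.exp (-∫ u in b..y, lam u))
      (y * lam y * Real.exp (-∫ u in b..y, lam u)) y := by
  have hE := continuous_exp_neg_integral h b
  have h1 : HasDerivAt (fun y => ∫ z in (0 : ℝ)..y, Real.exp (-∫ u in b..z, lam u)) _ y :=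
    intervalIntegral.integral_hasDerivAt_right (hE.intervalIntegrable _ _)
      hE.stronglyMeasurable.stronglyMeasurableAtFilter hE.continuousAt
  exact (h1.fun_sub ((hasDerivAt_id' y).fun_mul
    (hasDerivAt_exp_neg_integral h b y))).congr_deriv (by ring)

lemma integral_density_to_zero (h : Continuous lam) (b : ℝ) :
    (∫ y in b..(0 : ℝ), y * lam y * Real.exp (-∫ u in b..y, lam u)) =
      b + ∫ y in b..(0 : ℝ), Real.exp (-∫ u in b..y, lam u) := by
  have hE := continuous_exp_neg_integral h b
  rw [intervalIntegral.integral_eq_sub_of_hasDerivAt (fun y _ => hasDerivAt_parts h b y)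
    (((continuous_id.mul h).mul hE).intervalIntegrable _ _)]
  rw [intervalIntegral.integral_symm b 0]
  simp

lemma exp_neg_integral_le (h : Continuous lam) (hc : 0 < c) (hlb : ∀ u, c ≤ lam u)
    (hb : b ≤ 0) {y : ℝ} (hy : 0 ≤ y) :
    Real.exp (-∫ u in b..y, lam u) ≤ Real.exp (-c * y) := by
  have h1 : (∫ _ in b..y, c) ≤ ∫ u in b..y, lam u :=
    intervalIntegral.integral_mono (hb.trans hy) (continuous_const.intervalIntegrable _ _)
      (h.intervalIntegrable _ _) hlb
  rw [intervalIntegral.integral_const, smul_eq_mul] at h1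
  apply Real.exp_le_exp.2
  nlinarith

lemma integrableOn_exp_neg_integral (h : Continuous lam) (hc : 0 < c) (hlb : ∀ u, c ≤ lam u)
    (hb : b ≤ 0) : IntegrableOn (fun y => Real.exp (-∫ u in b..y, lam u)) (Ioi 0) := by
  refine Integrable.mono' (exp_neg_integrableOn_Ioi 0 hc)
    (continuous_exp_neg_integral h b).aestronglyMeasurable ?_
  refine (ae_restrict_iff' measurableSet_Ioi).2 (.of_forall fun y hy => ?_)
  rw [Real.norm_eq_abs, Real.abs_exp]
  exact exp_neg_integral_le h hc hlb hb (le_of_lt hy)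

lemma tendsto_mul_exp_neg_integral (h : Continuous lam) (hc : 0 < c) (hlb : ∀ u, c ≤ lam u)
    (hb : b ≤ 0) :
    Filter.Tendsto (fun y => y * Real.exp (-∫ u in b..y, lam u)) Filter.atTop (nhds 0) := by
  have h1 := tendsto_rpow_mul_exp_neg_mul_atTop_nhds_zero 1 c hc
  simp only [Real.rpow_one] at h1
  refine squeeze_zero' ?_ ?_ h1
  · filter_upwards [Filter.eventually_ge_atTop 0] with y hy
    positivity
  · filter_upwards [Filter.eventually_ge_atTop 0] with y hy
    exact mul_le_mul_of_nonneg_left (exp_neg_integral_le h hc hlb hb hy) hy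

lemma integral_density_Ioi (h : Continuous lam) (hc : 0 < c) (hlb : ∀ u, c ≤ lam u)
    (hb : b ≤ 0) :
    (∫ y in Ioi (0 : ℝ), y * lam y * Real.exp (-∫ u in b..y, lam u)) =
      ∫ y in Ioi (0 : ℝ), Real.exp (-∫ u in b..y, lam u) := by
  have hlim := (intervalIntegral_tendsto_integral_Ioi 0
    (integrableOn_exp_neg_integral h hc hlb hb) Filter.tendsto_id).sub
    (tendsto_mul_exp_neg_integral h hc hlb hb)
  rw [integral_Ioi_of_hasDerivAt_of_nonneg' (fun y _ => hasDerivAt_parts h b y) ?_ hlim]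
  · simp
  · intro y hy
    have := hc.trans_le (hlb y)
    have : (0 : ℝ) < y := hy
    positivity

lemma indifference_iff_of_continuous (h : Continuous lam) (hc : 0 < c) (hlb : ∀ u, c ≤ lam u)
    (hb : b ≤ 0) :
    b + (-(∫ y in b..(0 : ℝ), y * lam y * Real.exp (-∫ u in b..y, lam u)) +
        ∫ y in Ioi (0 : ℝ), y * lam y * Real.exp (-∫ u in b..y, lam u)) = 0 ↔
      (∫ y in b..(0 : ℝ), Real.exp (∫ u in y..(0 : ℝ), lam u)) =
        ∫ y in Ioi (0 : ℝ), Real.exp (-∫ u in (0 : ℝ)..y, lam u) := by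
  set k := Real.exp (-∫ u in b..(0 : ℝ), lam u)
  have hsplit (y : ℝ) : Real.exp (-∫ u in b..y, lam u) =
      k * Real.exp (-∫ u in (0 : ℝ)..y, lam u) := by
    rw [← Real.exp_add, ← intervalIntegral.integral_add_adjacent_intervals
      (h.intervalIntegrable b 0) (h.intervalIntegrable 0 y), neg_add]
  have hleft : (∫ y in b..(0 : ℝ), Real.exp (-∫ u in b..y, lam u)) =
      k * ∫ y in b..(0 : ℝ), Real.exp (∫ u in y..(0 : ℝ), lam u) := by
    rw [← intervalIntegral.integral_const_mul]
    refine intervalIntegral.integral_congr fun y _ => ?_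
    simp only [hsplit y, intervalIntegral.integral_symm 0 y]
  have hright : (∫ y in Ioi (0 : ℝ), Real.exp (-∫ u in b..y, lam u)) =
      k * ∫ y in Ioi (0 : ℝ), Real.exp (-∫ u in (0 : ℝ)..y, lam u) := by
    rw [← integral_const_mul]
    exact integral_congr_ae (.of_forall hsplit)
  have hk : k ≠ 0 := (Real.exp_pos _).ne'
  rw [integral_density_to_zero h, integral_density_Ioi h hc hlb hb, hleft, hright]
  refine Iff.trans ?_ (mul_right_inj' hk)
  constructor <;> intro heq <;> linarith

end SurvivalFunction

theorem stmt_3 (S : ℝ) (hS : S < 0) (lam : ℝ → ℝ) (c : ℝ) (hc : 0 < c)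
    (hcont : ContinuousOn lam (Set.Ici S)) (hlb : ∀ u ∈ Set.Ici S, c ≤ lam u)
    (F : ℝ → ℝ)
    (hF : ∀ b ∈ Set.Icc S 0,
      F b = -(∫ y in b..(0 : ℝ), y * lam y * Real.exp (-∫ u in b..y, lam u)) +
        ∫ y in Set.Ioi (0 : ℝ), y * lam y * Real.exp (-∫ u in b..y, lam u)) :
    ∀ b ∈ Set.Ico S 0,
      (b + F b = 0 ↔
        (∫ y in b..(0 : ℝ), Real.exp (∫ u in y..(0 : ℝ), lam u)) =
          ∫ y in Set.Ioi (0 : ℝ), Real.exp (-∫ u in (0 : ℝ)..y, lam u)) := by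
  rintro b ⟨hSb, hb⟩
  let L : ℝ → ℝ := fun u => lam (max S u)
  have hL : Continuous L :=
    hcont.comp_continuous (continuous_const.max continuous_id) fun u => le_max_left S u
  have hLlb (u : ℝ) : c ≤ L u := hlb _ (le_max_left S u)
  have hlamL {u : ℝ} (hu : S ≤ u) : lam u = L u := by simp [L, max_eq_right hu]
  have hint {x y : ℝ} (hx : S ≤ x) (hy : S ≤ y) : (∫ u in x..y, lam u) = ∫ u in x..y, L u :=
    intervalIntegral.integral_congr fun u hu => hlamL ((le_min hx hy).trans hu.1)
  have hge {y : ℝ} (hy : y ∈ uIcc b 0) : S ≤ y := (le_min hSb hS.le).trans hy.1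
  have e1 : (∫ y in b..(0 : ℝ), y * lam y * Real.exp (-∫ u in b..y, lam u)) =
      ∫ y in b..(0 : ℝ), y * L y * Real.exp (-∫ u in b..y, L u) :=
    intervalIntegral.integral_congr fun y hy => by
      simp only [hlamL (hge hy), hint hSb (hge hy)]
  have e2 : (∫ y in Ioi (0 : ℝ), y * lam y * Real.exp (-∫ u in b..y, lam u)) =
      ∫ y in Ioi (0 : ℝ), y * L y * Real.exp (-∫ u in b..y, L u) :=
    setIntegral_congr_fun measurableSet_Ioi fun y hy => by
      simp only [hlamL (hS.trans hy).le, hint hSb (hS.trans hy).le]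
  have e3 : (∫ y in b..(0 : ℝ), Real.exp (∫ u in y..(0 : ℝ), lam u)) =
      ∫ y in b..(0 : ℝ), Real.exp (∫ u in y..(0 : ℝ), L u) :=
    intervalIntegral.integral_congr fun y hy => by
      simp only [hint (hge hy) hS.le]
  have e4 : (∫ y in Ioi (0 : ℝ), Real.exp (-∫ u in (0 : ℝ)..y, lam u)) =
      ∫ y in Ioi (0 : ℝ), Real.exp (-∫ u in (0 : ℝ)..y, L u) :=
    setIntegral_congr_fun measurableSet_Ioi fun y hy => by
      simp only [hint hS.le (hS.trans hy).le]
  rw [hF b ⟨hSb, hb.le⟩, e1, e2, e3, e4]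
  exact indifference_iff_of_continuous hL hc hLlb hb.le
end

section
/- Let S < 0 and let λ : [S,∞) → ℝ be continuously differentiable with λ(u) ≥ c for all u ≥ S, for some constant c > 0. Define F(b) := -∫_b^0 y·λ(y)·exp(-∫_b^y λ(u) du) dy + ∫_0^∞ y·λ(y)·exp(-∫_b^y λ(u) du) dy for b ∈ [S,0]. Then F is twice continuously differentiable on (S,0) and F''(b) = λ'(b)·(b + F(b)) + λ(b)·(1 + λ(b)·(b + F(b))) for all b ∈ (S,0). -/
open MeasureTheory Set

/-- The fundamental theorem of calculus for a function continuous on an open half-line. -/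
lemma hasDerivAt_integral_of_continuousOn_Ioi {f : ℝ → ℝ} {S a b : ℝ}
    (hf : ContinuousOn f (Ioi S)) (ha : S < a) (hb : S < b) :
    HasDerivAt (fun x => ∫ y in a..x, f y) (f b) b :=
  intervalIntegral.integral_hasDerivAt_right
    (hf.mono ((ordConnected_Ioi).uIcc_subset ha hb)).intervalIntegrable
    (hf.stronglyMeasurableAtFilter isOpen_Ioi b hb) (hf.continuousAt (Ioi_mem_nhds hb))

theorem stmt_4 (S : ℝ) (hS : S < 0) (lam lam' : ℝ → ℝ) (c : ℝ) (hc : 0 < c)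
    (hderiv : ∀ u ∈ Set.Ici S, HasDerivAt lam (lam' u) u)
    (hcont' : ContinuousOn lam' (Set.Ici S))
    (hlb : ∀ u ∈ Set.Ici S, c ≤ lam u)
    (F : ℝ → ℝ)
    (hF : ∀ b ∈ Set.Icc S 0,
      F b = -(∫ y in b..(0 : ℝ), y * lam y * Real.exp (-∫ u in b..y, lam u)) +
        ∫ y in Set.Ioi (0 : ℝ), y * lam y * Real.exp (-∫ u in b..y, lam u)) :
    ∃ F' F'' : ℝ → ℝ,
      (∀ b ∈ Set.Ioo S 0, HasDerivAt F (F' b) b) ∧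
      (∀ b ∈ Set.Ioo S 0, HasDerivAt F' (F'' b) b) ∧
      ContinuousOn F'' (Set.Ioo S 0) ∧
      ∀ b ∈ Set.Ioo S 0,
        F'' b = lam' b * (b + F b) + lam b * (1 + lam b * (b + F b)) := by
  have hlam : ContinuousOn lam (Ioi S) := fun u hu =>
    (hderiv u (Ioi_subset_Ici_self hu)).continuousAt.continuousWithinAt
  have hint : ∀ a b, S < a → S < b → IntervalIntegrable lam volume a b := fun a b ha hb =>
    (hlam.mono ((ordConnected_Ioi).uIcc_subset ha hb)).intervalIntegrable
  set G : ℝ → ℝ := fun x => ∫ u in (0 : ℝ)..x, lam u with hG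
  have hGd : ∀ b, S < b → HasDerivAt G (lam b) b := fun b hb =>
    hasDerivAt_integral_of_continuousOn_Ioi hlam hS hb
  set h : ℝ → ℝ := fun y => y * lam y * Real.exp (-G y) with hh
  have hhc : ContinuousOn h (Ioi S) := by
    have hGc : ContinuousOn G (Ioi S) := fun u hu =>
      (hGd u hu).continuousAt.continuousWithinAt
    exact (continuousOn_id.mul hlam).mul (Real.continuous_exp.comp_continuousOn hGc.neg)
  set K : ℝ := ∫ y in Ioi (0 : ℝ), h y with hK
  have hfactor : ∀ b y, S < b → S < y →
      y * lam y * Real.exp (-∫ u in b..y, lam u) = Real.exp (G b) * h y := by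
    intro b y hb hy
    have hsub : ∫ u in b..y, lam u = G y - G b :=
      (intervalIntegral.integral_interval_sub_left (hint 0 y hS hy) (hint 0 b hS hb)).symm
    rw [hsub, show -(G y - G b) = G b + -G y by ring, Real.exp_add]
    simp only [hh]
    ring
  have hFeq : ∀ b ∈ Ioo S 0, F b = Real.exp (G b) * ((∫ y in (0 : ℝ)..b, h y) + K) := by
    intro b hb
    rw [hF b (Ioo_subset_Icc_self hb),
      intervalIntegral.integral_congr (g := fun y => Real.exp (G b) * h y)
        (fun y hy => hfactor b y hb.1 ((ordConnected_Ioi).uIcc_subset hb.1 hS hy)),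
      setIntegral_congr_fun (g := fun y => Real.exp (G b) * h y) measurableSet_Ioi
        (fun y hy => hfactor b y hb.1 (hS.trans hy)),
      intervalIntegral.integral_const_mul, integral_const_mul,
      intervalIntegral.integral_symm 0 b]
    ring
  have hFd : ∀ b ∈ Ioo S 0, HasDerivAt F (lam b * (b + F b)) b := by
    intro b hb
    have hprod := (hGd b hb.1).exp.mul
      ((hasDerivAt_integral_of_continuousOn_Ioi hhc hS hb.1).add_const K)
    refine (hprod.congr_of_eventuallyEq ?_).congr_deriv ?_
    · filter_upwards [Ioo_mem_nhds hb.1 hb.2] with x hx using hFeq x hx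
    · have hexp : Real.exp (G b) * Real.exp (-G b) = 1 := by
        rw [← Real.exp_add, add_neg_cancel, Real.exp_zero]
      rw [hFeq b hb]
      simp only [hh]
      linear_combination (b * lam b) * hexp
  have hFc : ContinuousOn F (Ioo S 0) := fun b hb =>
    (hFd b hb).continuousAt.continuousWithinAt
  refine ⟨fun b => lam b * (b + F b),
    fun b => lam' b * (b + F b) + lam b * (1 + lam b * (b + F b)), hFd, ?_, ?_,
    fun _ _ => rfl⟩
  · intro b hb
    exact (hderiv b hb.1.le).mul ((hasDerivAt_id b).add (hFd b hb))
  · have hl := hlam.mono (Ioo_subset_Ioi_self : Ioo S 0 ⊆ Ioi S)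
    have hl' := hcont'.mono (fun x hx => hx.1.le : Ioo S 0 ⊆ Ici S)
    fun_prop
end

section
/- Let S < 0 and let ℓ > ln(2)/|S| be a constant, and let λ : [S,∞) → ℝ be the constant function λ(u) = ℓ. Define F(b) := -∫_b^0 y·λ(y)·exp(-∫_b^y λ(u) du) dy + ∫_0^∞ y·λ(y)·exp(-∫_b^y λ(u) du) dy for b ∈ [S,0]. Then b* := -ln(2)/ℓ lies in (S,0), satisfies ∫_{b*}^0 exp(∫_y^0 λ(u) du) dy = ∫_0^∞ exp(-∫_0^y λ(u) du) dy, F(b*) ≤ F(b) for all b ∈ [S,0], and moreover F(b) - F(b*) = (1/ℓ)·(2·e^{ℓ·b} - 1) - b - ln(2)/ℓ for all b ∈ [S,0]. -/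
open MeasureTheory Set

lemma hasDerivAt_neg_add_inv_mul_exp {l : ℝ} (hl : l ≠ 0) (b y : ℝ) :
    HasDerivAt (fun y : ℝ => -(y + 1 / l) * Real.exp (-((y - b) * l)))
      (y * l * Real.exp (-((y - b) * l))) y := by
  have h₁ : HasDerivAt (fun y : ℝ => -(y + 1 / l)) (-1) y :=
    ((hasDerivAt_id y).add_const (1 / l)).neg
  have h₂ : HasDerivAt (fun y : ℝ => -((y - b) * l)) (-(1 * l)) y :=
    (((hasDerivAt_id y).sub_const b).mul_const l).neg
  refine (h₁.mul h₂.exp).congr_deriv ?_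
  field_simp
  ring

lemma integral_mul_exp_neg {l : ℝ} (hl : l ≠ 0) (b : ℝ) :
    ∫ y in b..(0 : ℝ), y * l * Real.exp (-((y - b) * l)) =
      -(1 / l) * Real.exp (l * b) + b + 1 / l := by
  rw [intervalIntegral.integral_eq_sub_of_hasDerivAt
    (fun y _ => hasDerivAt_neg_add_inv_mul_exp hl b y)
    (Continuous.intervalIntegrable (by fun_prop) _ _)]
  simp only [sub_self, zero_mul, neg_zero, Real.exp_zero, zero_sub, neg_mul, neg_neg,
    mul_comm b l]
  ring

lemma tendsto_neg_add_inv_mul_exp {l : ℝ} (hl : 0 < l) (b : ℝ) :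
    Filter.Tendsto (fun y : ℝ => -(y + 1 / l) * Real.exp (-((y - b) * l)))
      Filter.atTop (nhds 0) := by
  have hlin : Filter.Tendsto (fun y : ℝ => l * y) Filter.atTop Filter.atTop :=
    Filter.tendsto_id.const_mul_atTop hl
  have h₁ := (Real.tendsto_pow_mul_exp_neg_atTop_nhds_zero 1).comp hlin
  have h₀ := (Real.tendsto_pow_mul_exp_neg_atTop_nhds_zero 0).comp hlin
  have h := (h₁.add h₀).const_mul (-(1 / l) * Real.exp (l * b))
  simp only [add_zero, mul_zero] at h
  refine h.congr fun y => ?_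
  have he : Real.exp (-((y - b) * l)) = Real.exp (l * b) * Real.exp (-(l * y)) := by
    rw [← Real.exp_add]
    ring_nf
  simp only [Function.comp_apply, pow_one, pow_zero, he]
  field_simp

lemma integral_Ioi_mul_exp_neg {l : ℝ} (hl : 0 < l) (b : ℝ) :
    ∫ y in Ioi (0 : ℝ), y * l * Real.exp (-((y - b) * l)) = 1 / l * Real.exp (l * b) := by
  rw [integral_Ioi_of_hasDerivAt_of_nonneg'
    (fun y _ => hasDerivAt_neg_add_inv_mul_exp hl.ne' b y)
    (fun y hy => by have := mem_Ioi.1 hy; positivity) (tendsto_neg_add_inv_mul_exp hl b)]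
  simp [mul_comm b l]

theorem stmt_5 (S l : ℝ) (hS : S < 0) (hl : Real.log 2 / |S| < l)
    (lam : ℝ → ℝ) (hlam : ∀ u, lam u = l)
    (F : ℝ → ℝ)
    (hF : ∀ b ∈ Set.Icc S 0,
      F b = -(∫ y in b..(0 : ℝ), y * lam y * Real.exp (-∫ u in b..y, lam u)) +
        ∫ y in Set.Ioi (0 : ℝ), y * lam y * Real.exp (-∫ u in b..y, lam u)) :
    -(Real.log 2) / l ∈ Set.Ioo S 0 ∧
    (∫ y in (-(Real.log 2) / l)..(0 : ℝ), Real.exp (∫ u in y..(0 : ℝ), lam u)) =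
      (∫ y in Set.Ioi (0 : ℝ), Real.exp (-∫ u in (0 : ℝ)..y, lam u)) ∧
    (∀ b ∈ Set.Icc S 0, F (-(Real.log 2) / l) ≤ F b) ∧
    ∀ b ∈ Set.Icc S 0,
      F b - F (-(Real.log 2) / l) =
        (1 / l) * (2 * Real.exp (l * b) - 1) - b - Real.log 2 / l := by
  have hlog : 0 < Real.log 2 := Real.log_pos one_lt_two
  have hl₀ : 0 < l := (div_pos hlog (abs_pos.2 hS.ne)).trans hl
  have hmem : -(Real.log 2) / l ∈ Ioo S 0 := by
    rw [abs_of_neg hS, div_lt_iff₀ (neg_pos.2 hS)] at hl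
    refine ⟨?_, div_neg_of_neg_of_pos (neg_neg_iff_pos.2 hlog) hl₀⟩
    rw [lt_div_iff₀ hl₀]
    linarith
  obtain rfl : lam = fun _ => l := funext hlam
  simp only [intervalIntegral.integral_const, smul_eq_mul] at hF ⊢
  have hF_eq : ∀ b ∈ Icc S 0, F b = 2 / l * Real.exp (l * b) - b - 1 / l := fun b hb => by
    rw [hF b hb, integral_mul_exp_neg hl₀.ne', integral_Ioi_mul_exp_neg hl₀]
    ring
  have hgap : ∀ b ∈ Icc S 0, F b - F (-(Real.log 2) / l) =
      (1 / l) * (2 * Real.exp (l * b) - 1) - b - Real.log 2 / l := fun b hb => by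
    rw [hF_eq b hb, hF_eq _ (Ioo_subset_Icc_self hmem), mul_div_cancel₀ _ hl₀.ne',
      Real.exp_neg, Real.exp_log two_pos]
    ring
  refine ⟨hmem, ?_, fun b hb => ?_, hgap⟩
  · have hderiv : ∀ y : ℝ, HasDerivAt (fun y : ℝ => -(1 / l) * Real.exp (-(y * l)))
        (Real.exp (-(y * l))) y := fun y => by
      have h : HasDerivAt (fun y : ℝ => -(y * l)) (-(1 * l)) y :=
        ((hasDerivAt_id y).mul_const l).neg
      refine (h.exp.const_mul (-(1 / l))).congr_deriv ?_
      field_simp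
    have htendsto : Filter.Tendsto (fun y : ℝ => -(1 / l) * Real.exp (-(y * l)))
        Filter.atTop (nhds 0) := by
      have h := (Real.tendsto_exp_neg_atTop_nhds_zero.comp
        (Filter.tendsto_id.atTop_mul_const hl₀)).const_mul (-(1 / l))
      simpa using h
    have hright : ∫ y in Ioi (0 : ℝ), Real.exp (-((y - 0) * l)) = 1 / l := by
      simp only [sub_zero]
      rw [integral_Ioi_of_hasDerivAt_of_nonneg' (fun y _ => hderiv y)
        (fun y _ => (Real.exp_pos _).le) htendsto]
      simp
    rw [hright]
    simp only [zero_sub, neg_mul]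
    rw [intervalIntegral.integral_eq_sub_of_hasDerivAt (fun y _ => hderiv y)
      (Continuous.intervalIntegrable (by fun_prop) _ _), div_mul_cancel₀ _ hl₀.ne', neg_neg,
      Real.exp_log two_pos]
    simp only [zero_mul, neg_zero, Real.exp_zero]
    ring
  · have h := Real.add_one_le_exp (Real.log 2 + l * b)
    rw [Real.exp_add, Real.exp_log two_pos] at h
    have h' : 0 ≤ (2 * Real.exp (l * b) - 1 - l * b - Real.log 2) / l :=
      div_nonneg (by linarith) hl₀.le
    have heq : (2 * Real.exp (l * b) - 1 - l * b - Real.log 2) / l =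
        (1 / l) * (2 * Real.exp (l * b) - 1) - b - Real.log 2 / l := by
      field_simp
    rw [heq, ← hgap b hb] at h'
    linarith
end

section
/- Let S < 0, L > 1, and let λ : [S,∞) → ℝ be continuously differentiable with ln(2)/|S| + 1/L ≤ λ(u) ≤ L and |λ'(u)| ≤ L for all u ≥ S. Then there exists a unique b* ∈ (S,0) satisfying ∫_{b*}^0 exp(∫_y^0 λ(u) du) dy = ∫_0^∞ exp(-∫_0^y λ(u) du) dy; moreover this b* satisfies b* - S ≥ |S| - ln(2)·(ln(2)/|S| + 1/L)^{-1} > 0. -/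
open MeasureTheory Set

/-- If the intensity `g` is bounded below by `m > 0`, the balance equation between the two
exponential integrals has a unique solution, which lies in `[-log 2 / m, 0)`. -/
theorem exists_unique_balance_of_le {g : ℝ → ℝ} (hg : Continuous g) {m : ℝ} (hm : 0 < m)
    (hmg : ∀ u, m ≤ g u) :
    ∃ bs ∈ Ico (-(Real.log 2 * m⁻¹)) 0,
      (∫ y in bs..(0 : ℝ), Real.exp (∫ u in y..(0 : ℝ), g u)) =
        ∫ y in Ioi (0 : ℝ), Real.exp (-∫ u in (0 : ℝ)..y, g u) ∧
      ∀ b, (∫ y in b..(0 : ℝ), Real.exp (∫ u in y..(0 : ℝ), g u)) =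
        ∫ y in Ioi (0 : ℝ), Real.exp (-∫ u in (0 : ℝ)..y, g u) → b = bs := by
  have hgi : ∀ a b, IntervalIntegrable g volume a b := fun a b => hg.intervalIntegrable a b
  simp only [← intervalIntegral.integral_symm]
  set f : ℝ → ℝ := fun y => Real.exp (∫ u in y..(0 : ℝ), g u) with hf
  have hfc : Continuous f := by
    have h : f = fun y => Real.exp (-∫ u in (0 : ℝ)..y, g u) := by
      funext y
      rw [hf, ← intervalIntegral.integral_symm]
    rw [h]
    exact (intervalIntegral.continuous_primitive hgi 0).neg.rexp
  have hfpos : ∀ y, 0 < f y := fun y => Real.exp_pos _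
  have hfi : ∀ a b, IntervalIntegrable f volume a b := fun a b => hfc.intervalIntegrable a b
  have hle : ∀ y ∈ Ioi (0 : ℝ), f y ≤ Real.exp (-m * y) := by
    intro y hy
    have h := intervalIntegral.integral_mono_on (le_of_lt hy) intervalIntegrable_const
      (hgi 0 y) (fun u _ => hmg u)
    rw [intervalIntegral.integral_const, smul_eq_mul] at h
    refine Real.exp_le_exp.2 ?_
    rw [intervalIntegral.integral_symm]
    linarith
  have hge : ∀ y ≤ (0 : ℝ), Real.exp (-m * y) ≤ f y := by
    intro y hy
    have h := intervalIntegral.integral_mono_on hy intervalIntegrable_const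
      (hgi y 0) (fun u _ => hmg u)
    rw [intervalIntegral.integral_const, smul_eq_mul] at h
    refine Real.exp_le_exp.2 ?_
    linarith
  have hexp : IntegrableOn (fun y => Real.exp (-m * y)) (Ioi 0) :=
    integrableOn_exp_mul_Ioi (neg_lt_zero.2 hm) 0
  have hfI : IntegrableOn f (Ioi 0) := by
    refine Integrable.mono' hexp hfc.aestronglyMeasurable ?_
    filter_upwards [ae_restrict_mem measurableSet_Ioi] with y hy
    rw [Real.norm_of_nonneg (hfpos y).le]
    exact hle y hy
  have hI_le : ∫ y in Ioi (0 : ℝ), f y ≤ m⁻¹ := by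
    refine (setIntegral_mono_on hfI hexp measurableSet_Ioi hle).trans_eq ?_
    rw [integral_exp_mul_Ioi (neg_lt_zero.2 hm)]
    simp
  have hI_pos : 0 < ∫ y in Ioi (0 : ℝ), f y := by
    rw [setIntegral_pos_iff_support_of_nonneg_ae (ae_of_all _ fun y => (hfpos y).le) hfI]
    have : Function.support f = univ := by
      ext y
      simp [(hfpos y).ne']
    simp [this]
  have hb0 : -(Real.log 2 * m⁻¹) ≤ 0 := by
    have := Real.log_pos one_lt_two
    have : 0 < Real.log 2 * m⁻¹ := by positivity
    linarith
  have hF_ge : m⁻¹ ≤ ∫ y in -(Real.log 2 * m⁻¹)..(0 : ℝ), f y := by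
    refine le_trans (le_of_eq ?_) (intervalIntegral.integral_mono_on hb0
      (Continuous.intervalIntegrable (by fun_prop) _ _) (hfi _ _) fun y hy => hge y hy.2)
    rw [intervalIntegral.integral_comp_mul_left (fun x => Real.exp x) (neg_ne_zero.2 hm.ne'),
      integral_exp]
    have h : -m * -(Real.log 2 * m⁻¹) = Real.log 2 := by field_simp
    rw [h, Real.exp_log two_pos, mul_zero, Real.exp_zero, smul_eq_mul, inv_neg]
    ring
  have hFc : Continuous fun b => ∫ y in b..(0 : ℝ), f y := by
    simp only [intervalIntegral.integral_symm 0]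
    exact (intervalIntegral.continuous_primitive hfi 0).neg
  obtain ⟨bs, hbs, hbs_eq⟩ := intermediate_value_Icc' hb0 hFc.continuousOn
    (show (∫ y in Ioi (0 : ℝ), f y) ∈ _ from ⟨by simpa using hI_pos.le, hI_le.trans hF_ge⟩)
  have hmono : ∀ a b, a < b → ∫ y in b..(0 : ℝ), f y < ∫ y in a..(0 : ℝ), f y := by
    intro a b hab
    rw [← intervalIntegral.integral_add_adjacent_intervals (hfi a b) (hfi b 0)]
    linarith [intervalIntegral.intervalIntegral_pos_of_pos (hfi a b) hfpos hab]
  refine ⟨bs, ⟨hbs.1, hbs.2.lt_of_ne ?_⟩, hbs_eq, fun b hb => ?_⟩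
  · rintro rfl
    simp only [intervalIntegral.integral_same] at hbs_eq
    exact hI_pos.ne hbs_eq
  · have h := hb.trans hbs_eq.symm
    rcases lt_trichotomy b bs with hlt | heq | hlt
    · exact absurd h (hmono _ _ hlt).ne'
    · exact heq
    · exact absurd h (hmono _ _ hlt).ne

theorem stmt_6 (S L : ℝ) (hS : S < 0) (hL : 1 < L)
    (lam lam' : ℝ → ℝ)
    (hderiv : ∀ u ∈ Set.Ici S, HasDerivAt lam (lam' u) u)
    (hcont' : ContinuousOn lam' (Set.Ici S))
    (hbounds : ∀ u ∈ Set.Ici S,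
      Real.log 2 / |S| + 1 / L ≤ lam u ∧ lam u ≤ L ∧ |lam' u| ≤ L) :
    ∃ bs ∈ Set.Ioo S 0,
      ((∫ y in bs..(0 : ℝ), Real.exp (∫ u in y..(0 : ℝ), lam u)) =
        ∫ y in Set.Ioi (0 : ℝ), Real.exp (-∫ u in (0 : ℝ)..y, lam u)) ∧
      (∀ b ∈ Set.Ioo S 0,
        ((∫ y in b..(0 : ℝ), Real.exp (∫ u in y..(0 : ℝ), lam u)) =
          ∫ y in Set.Ioi (0 : ℝ), Real.exp (-∫ u in (0 : ℝ)..y, lam u)) → b = bs) ∧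
      |S| - Real.log 2 * (Real.log 2 / |S| + 1 / L)⁻¹ ≤ bs - S ∧
      0 < |S| - Real.log 2 * (Real.log 2 / |S| + 1 / L)⁻¹ := by
  have hlog := Real.log_pos one_lt_two
  have hS' : 0 < |S| := abs_pos.2 hS.ne
  have hL' : 0 < L := zero_lt_one.trans hL
  set m := Real.log 2 / |S| + 1 / L with hm_def
  have hm : 0 < m := by positivity
  have hgap : Real.log 2 * m⁻¹ < |S| := by
    rw [← div_eq_mul_inv, div_lt_iff₀ hm, hm_def, mul_add, mul_div_cancel₀ _ hS'.ne']
    have : 0 < |S| * (1 / L) := by positivity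
    linarith
  have hSabs : |S| = -S := abs_of_neg hS
  let g : ℝ → ℝ := fun u => lam (max u S)
  have hg : Continuous g := by
    have h : ContinuousOn lam (Ici S) := fun u hu => (hderiv u hu).continuousAt.continuousWithinAt
    exact h.comp_continuous (by fun_prop) fun u => le_max_right u S
  have hmg : ∀ u, m ≤ g u := fun u => (hbounds _ (le_max_right u S)).1
  have hgl : ∀ a b, S ≤ a → S ≤ b → ∫ u in a..b, g u = ∫ u in a..b, lam u := by
    intro a b ha hb
    refine intervalIntegral.integral_congr fun u hu => ?_
    exact congrArg lam (max_eq_left ((le_inf ha hb).trans hu.1))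
  have hleft : ∀ b, S ≤ b → ∫ y in b..(0 : ℝ), Real.exp (∫ u in y..(0 : ℝ), g u) =
      ∫ y in b..(0 : ℝ), Real.exp (∫ u in y..(0 : ℝ), lam u) := by
    intro b hb
    refine intervalIntegral.integral_congr fun y hy => ?_
    exact congrArg Real.exp (hgl y 0 ((le_inf hb hS.le).trans hy.1) hS.le)
  have hright : ∫ y in Ioi (0 : ℝ), Real.exp (-∫ u in (0 : ℝ)..y, g u) =
      ∫ y in Ioi (0 : ℝ), Real.exp (-∫ u in (0 : ℝ)..y, lam u) := by
    refine setIntegral_congr_fun measurableSet_Ioi fun y hy => ?_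
    exact congrArg (fun x => Real.exp (-x)) (hgl 0 y hS.le (hS.trans hy).le)
  obtain ⟨bs, hbs, heq, huniq⟩ := exists_unique_balance_of_le hg hm hmg
  have hSbs : S < bs := by linarith [hbs.1]
  refine ⟨bs, ⟨hSbs, hbs.2⟩, ?_, fun b hb h => huniq b ?_, by linarith [hbs.1], by linarith⟩
  · rw [← hleft bs hSbs.le, ← hright, heq]
  · rw [hleft b hb.1.le, hright, h]
end

section
/- Let S < 0 and let λ : [S,0] → ℝ be a nonnegative integrable function; set Λ(y) := ∫_y^0 λ(u) du for y ∈ [S,0]. Let Γ : [S,0] → ℝ be measurable with |Γ(y) - Λ(y)| ≤ 1 for all y ∈ [S,0]. Suppose b*, b̂ ∈ [S,0], μ, φ ∈ ℝ satisfy ∫_{b*}^0 e^{Λ(y)} dy = μ and ∫_{b̂}^0 e^{Γ(y)} dy = φ. Then |b̂ - b*| ≤ |μ - φ| + 2·∫_S^0 e^{Λ(y)}·|Γ(y) - Λ(y)| dy. -/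
open MeasureTheory Set

theorem stmt_9 (S : ℝ) (hS : S < 0) (lam : ℝ → ℝ)
    (hnn : ∀ u ∈ Set.Icc S 0, 0 ≤ lam u)
    (hint : IntegrableOn lam (Set.Icc S 0))
    (Lam Gam : ℝ → ℝ)
    (hLam : ∀ y, Lam y = ∫ u in y..(0 : ℝ), lam u)
    (hGamMeas : Measurable Gam)
    (hclose : ∀ y ∈ Set.Icc S 0, |Gam y - Lam y| ≤ 1)
    (bs bh μ φ : ℝ) (hbs : bs ∈ Set.Icc S 0) (hbh : bh ∈ Set.Icc S 0)
    (h1 : (∫ y in bs..(0 : ℝ), Real.exp (Lam y)) = μ)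
    (h2 : (∫ y in bh..(0 : ℝ), Real.exp (Gam y)) = φ) :
    |bh - bs| ≤ |μ - φ| + 2 * ∫ y in S..(0 : ℝ), Real.exp (Lam y) * |Gam y - Lam y| := by
  have hLamC : ContinuousOn Lam (Icc S 0) := by
    rw [funext hLam, ← uIcc_of_le hS.le]
    apply intervalIntegral.continuousOn_primitive_interval_left
    rwa [uIcc_of_le hS.le]
  have hLam0 : ∀ y ∈ Icc S 0, 0 ≤ Lam y := by
    intro y hy
    rw [hLam]
    exact intervalIntegral.integral_nonneg hy.2 fun u hu => hnn u ⟨hy.1.trans hu.1, hu.2⟩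
  have hE : IntegrableOn (fun y => Real.exp (Lam y)) (Icc S 0) :=
    (Real.continuous_exp.comp_continuousOn hLamC).integrableOn_Icc
  have hLamM : AEStronglyMeasurable Lam (volume.restrict (Icc S 0)) :=
    hLamC.aestronglyMeasurable measurableSet_Icc
  have hP : IntegrableOn (fun y => Real.exp (Lam y) * |Gam y - Lam y|) (Icc S 0) := by
    refine Integrable.mono' hE (hE.aestronglyMeasurable.mul
      (hGamMeas.aestronglyMeasurable.sub hLamM).norm) ?_
    filter_upwards [ae_restrict_mem measurableSet_Icc] with y hy
    rw [Real.norm_of_nonneg (by positivity)]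
    exact mul_le_of_le_one_right (Real.exp_pos _).le (hclose y hy)
  have hG : IntegrableOn (fun y => Real.exp (Gam y)) (Icc S 0) := by
    refine Integrable.mono' (hE.mul_const (Real.exp 1))
      (Real.measurable_exp.comp hGamMeas).aestronglyMeasurable ?_
    filter_upwards [ae_restrict_mem measurableSet_Icc] with y hy
    rw [Real.norm_of_nonneg (Real.exp_pos _).le, ← Real.exp_add]
    exact Real.exp_le_exp.2 (by linarith [(abs_le.1 (hclose y hy)).2])
  have h0 : (0 : ℝ) ∈ Icc S 0 := ⟨hS.le, le_rfl⟩
  have hS' : S ∈ Icc S 0 := ⟨le_rfl, hS.le⟩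
  have toInterval : ∀ {f : ℝ → ℝ}, IntegrableOn f (Icc S 0) → ∀ {a b : ℝ}, a ∈ Icc S 0 →
      b ∈ Icc S 0 → IntervalIntegrable f volume a b := fun hf _ _ ha hb =>
    (hf.mono_set (uIcc_subset_Icc ha hb)).intervalIntegrable
  have hgap : ∀ a b : ℝ, a ∈ Icc S 0 → b ∈ Icc S 0 → a ≤ b →
      b - a ≤ ∫ y in a..b, Real.exp (Lam y) := by
    intro a b ha hb hab
    have := intervalIntegral.integral_mono_on (f := fun _ => (1 : ℝ)) hab
      (intervalIntegrable_const) (toInterval hE ha hb)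
      fun y hy => Real.one_le_exp (hLam0 y ⟨ha.1.trans hy.1, hy.2.trans hb.2⟩)
    simpa using this
  have hdist : |bh - bs| ≤ |∫ y in bh..bs, Real.exp (Lam y)| := by
    rcases le_total bh bs with h | h
    · rw [abs_sub_comm, abs_of_nonneg (sub_nonneg.2 h)]
      exact (hgap bh bs hbh hbs h).trans (le_abs_self _)
    · rw [abs_of_nonneg (sub_nonneg.2 h), intervalIntegral.integral_symm, abs_neg]
      exact (hgap bs bh hbs hbh h).trans (le_abs_self _)
  have hperturb : |∫ y in bh..(0 : ℝ), (Real.exp (Gam y) - Real.exp (Lam y))| ≤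
      2 * ∫ y in S..(0 : ℝ), Real.exp (Lam y) * |Gam y - Lam y| := by
    have hbound : ∀ y ∈ Icc S 0, |Real.exp (Gam y) - Real.exp (Lam y)| ≤
        2 * (Real.exp (Lam y) * |Gam y - Lam y|) := by
      intro y hy
      have hfactor : Real.exp (Gam y) - Real.exp (Lam y) =
          Real.exp (Lam y) * (Real.exp (Gam y - Lam y) - 1) := by
        rw [mul_sub, ← Real.exp_add]
        ring_nf
      rw [hfactor, abs_mul, abs_of_pos (Real.exp_pos _)]
      nlinarith [Real.abs_exp_sub_one_le (hclose y hy), Real.exp_pos (Lam y)]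
    calc |∫ y in bh..(0 : ℝ), (Real.exp (Gam y) - Real.exp (Lam y))|
        ≤ ∫ y in bh..(0 : ℝ), |Real.exp (Gam y) - Real.exp (Lam y)| :=
          intervalIntegral.abs_integral_le_integral_abs hbh.2
      _ ≤ ∫ y in bh..(0 : ℝ), 2 * (Real.exp (Lam y) * |Gam y - Lam y|) :=
          intervalIntegral.integral_mono_on hbh.2
            (toInterval (hG.sub hE).abs hbh h0) (toInterval (hP.const_mul 2) hbh h0)
            fun y hy => hbound y ⟨hbh.1.trans hy.1, hy.2⟩
      _ = 2 * ∫ y in bh..(0 : ℝ), Real.exp (Lam y) * |Gam y - Lam y| :=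
          intervalIntegral.integral_const_mul _ _
      _ ≤ 2 * ∫ y in S..(0 : ℝ), Real.exp (Lam y) * |Gam y - Lam y| := by
          rw [← intervalIntegral.integral_add_adjacent_intervals
            (toInterval hP hS' hbh) (toInterval hP hbh h0)]
          have : 0 ≤ ∫ y in S..bh, Real.exp (Lam y) * |Gam y - Lam y| :=
            intervalIntegral.integral_nonneg hbh.1 fun y _ => by positivity
          linarith
  have hsub := intervalIntegral.integral_sub (toInterval hG hbh h0) (toInterval hE hbh h0)
  have hadd := intervalIntegral.integral_add_adjacent_intervals
    (toInterval hE hbh hbs) (toInterval hE hbs h0)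
  have hsplit : (∫ y in bh..bs, Real.exp (Lam y)) =
      -((μ - φ) + ∫ y in bh..(0 : ℝ), (Real.exp (Gam y) - Real.exp (Lam y))) := by
    linarith
  rw [hsplit, abs_neg] at hdist
  exact hdist.trans ((abs_add_le _ _).trans (by gcongr))
end

section
/- Let S < 0 and let λ : [S,0] → ℝ be a nonnegative integrable function; set Λ(y) := ∫_y^0 λ(u) du for y ∈ [S,0]. Suppose b* ∈ (S,0] and μ > 0 satisfy ∫_{b*}^0 e^{Λ(y)} dy = μ, and set δ := b* - S. Let ε > 0 satisfy ε < min{μ, 1, δ/(3 + 2μ)}. Let Γ : [S,0] → ℝ be measurable with |Γ(y) - Λ(y)| ≤ ε for all y ∈ [S,0], and let φ ∈ ℝ with |φ - μ| ≤ ε. Then every b̂ ∈ [S,0] with ∫_{b̂}^0 e^{Γ(y)} dy = φ satisfies b̂ > S. -/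
open MeasureTheory Set

theorem stmt_10 (S : ℝ) (hS : S < 0) (lam : ℝ → ℝ)
    (hnn : ∀ u ∈ Set.Icc S 0, 0 ≤ lam u)
    (hint : IntegrableOn lam (Set.Icc S 0))
    (Lam : ℝ → ℝ) (hLam : ∀ y, Lam y = ∫ u in y..(0 : ℝ), lam u)
    (bs : ℝ) (hbs : bs ∈ Set.Ioc S 0) (μ : ℝ) (hμ : 0 < μ)
    (h1 : (∫ y in bs..(0 : ℝ), Real.exp (Lam y)) = μ)
    (ε : ℝ) (hε0 : 0 < ε)
    (hε : ε < min μ (min 1 ((bs - S) / (3 + 2 * μ))))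
    (Gam : ℝ → ℝ) (hGamMeas : Measurable Gam)
    (hclose : ∀ y ∈ Set.Icc S 0, |Gam y - Lam y| ≤ ε)
    (φ : ℝ) (hφ : |φ - μ| ≤ ε) :
    ∀ bh ∈ Set.Icc S 0, (∫ y in bh..(0 : ℝ), Real.exp (Gam y)) = φ → S < bh := by
  rintro bh ⟨hbhS, hbh0⟩ hbh
  refine lt_of_le_of_ne hbhS ?_
  rintro rfl
  obtain ⟨hSb, hb0⟩ := hbs
  simp only [lt_min_iff] at hε
  obtain ⟨-, hε1, hεδ⟩ := hε
  rw [lt_div_iff₀ (by positivity)] at hεδ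
  have hlam : IntervalIntegrable lam volume S 0 :=
    (intervalIntegrable_iff_integrableOn_Icc_of_le hbh0).2 hint
  have hcont : ContinuousOn (fun y => Real.exp (Lam y)) (Set.Icc S 0) := by
    have h := intervalIntegral.continuousOn_primitive_interval' hlam right_mem_uIcc
    rw [uIcc_of_le hbh0] at h
    refine (h.neg.congr fun y _ => ?_).rexp
    rw [hLam y, intervalIntegral.integral_symm]
    rfl
  have hLamInt : IntervalIntegrable (fun y => Real.exp (Lam y)) volume S 0 :=
    hcont.intervalIntegrable_of_Icc hbh0
  have hGamInt : IntervalIntegrable (fun y => Real.exp (Gam y)) volume S 0 := by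
    rw [intervalIntegrable_iff_integrableOn_Icc_of_le hbh0] at hLamInt ⊢
    refine (hLamInt.const_mul (Real.exp ε)).mono'
      hGamMeas.exp.aestronglyMeasurable ?_
    filter_upwards [ae_restrict_mem measurableSet_Icc] with y hy
    rw [Real.norm_eq_abs, Real.abs_exp, ← Real.exp_add]
    exact Real.exp_le_exp.2 (by linarith [(abs_le.1 (hclose y hy)).2])
  have hle : (∫ y in S..0, Real.exp (Lam y)) ≤ Real.exp ε * φ := by
    rw [← hbh, ← intervalIntegral.integral_const_mul]
    refine intervalIntegral.integral_mono_on hbh0 hLamInt (hGamInt.const_mul _) fun y hy => ?_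
    rw [← Real.exp_add]
    exact Real.exp_le_exp.2 (by linarith [(abs_le.1 (hclose y hy)).1])
  have hI1 : IntervalIntegrable (fun y => Real.exp (Lam y)) volume S bs :=
    (hcont.mono (Icc_subset_Icc_right hb0)).intervalIntegrable_of_Icc hSb.le
  have hI2 : IntervalIntegrable (fun y => Real.exp (Lam y)) volume bs 0 :=
    (hcont.mono (Icc_subset_Icc_left hSb.le)).intervalIntegrable_of_Icc hb0
  have hδ : bs - S ≤ ∫ y in S..bs, Real.exp (Lam y) := by
    have h : (∫ _ in S..bs, (1 : ℝ)) ≤ ∫ y in S..bs, Real.exp (Lam y) := by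
      refine intervalIntegral.integral_mono_on hSb.le intervalIntegrable_const hI1 fun y hy => ?_
      rw [Real.one_le_exp_iff, hLam]
      exact intervalIntegral.integral_nonneg (hy.2.trans hb0)
        fun u hu => hnn u ⟨hy.1.trans hu.1, hu.2⟩
    simpa using h
  have hsplit := intervalIntegral.integral_add_adjacent_intervals hI1 hI2
  have hexp : Real.exp ε ≤ 1 + 2 * ε := by
    have h := Real.abs_exp_sub_one_le (x := ε) (by rw [abs_of_pos hε0]; exact hε1.le)
    rw [abs_of_pos hε0] at h
    linarith [(abs_le.1 h).2]
  have hup : Real.exp ε * φ ≤ (1 + 2 * ε) * (μ + ε) :=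
    (mul_le_mul_of_nonneg_left (by linarith [(abs_le.1 hφ).2]) (Real.exp_pos ε).le).trans
      (mul_le_mul_of_nonneg_right hexp (by positivity))
  nlinarith
end

section
/- Let S < 0 and let 0 < a < b be real numbers with a = ln(2)/|S| + 1/L and b = L for some L > 1. For ℓ ∈ [a,b] define Δ_ℓ(x) := (1/ℓ)·(2·e^{ℓ·x} - 1) - x - ln(2)/ℓ for x ∈ [S,0]. Then there exists a constant c > 0 such that for all ℓ ∈ [a,b] and all x ∈ [S,0]: Δ_ℓ(x) ≥ c·(x + ln(2)/ℓ)². -/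
open Real Set

/-- Quadratic lower bound for the remainder `exp y - 1 - y` on a half-line `[-M, ∞)`. -/
theorem sq_div_le_exp_sub_one_sub {M y : ℝ} (hM : 0 ≤ M) (hy : -M ≤ y) :
    y ^ 2 / (4 + 2 * M) ≤ exp y - 1 - y := by
  rw [div_le_iff₀ (by positivity)]
  rcases le_total (-2) y with h | h
  · have hsq : exp y = exp (y / 2) ^ 2 := by
      rw [← exp_nat_mul]
      congr 1
      push_cast
      ring
    have hexp : (1 + y / 2) ^ 2 ≤ exp y := by
      rw [hsq]
      exact pow_le_pow_left₀ (by linarith) (by linarith [add_one_le_exp (y / 2)]) 2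
    nlinarith [mul_nonneg hM (sq_nonneg y)]
  · have hexp : -y / 2 ≤ exp y - 1 - y := by linarith [exp_pos y]
    nlinarith

theorem stmt_13 (S L a b : ℝ) (hS : S < 0) (hL : 1 < L)
    (ha : a = Real.log 2 / |S| + 1 / L) (hb : b = L)
    (ha0 : 0 < a) (hab : a < b) :
    ∃ c > 0, ∀ l ∈ Set.Icc a b, ∀ x ∈ Set.Icc S 0,
      c * (x + Real.log 2 / l) ^ 2 ≤
        (1 / l) * (2 * Real.exp (l * x) - 1) - x - Real.log 2 / l := by
  have hM : 0 ≤ -(L * S) := by nlinarith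
  refine ⟨a / (4 + 2 * -(L * S)), by positivity, ?_⟩
  rintro l ⟨hal, hlb⟩ x ⟨hSx, -⟩
  have hl : 0 < l := ha0.trans_le hal
  have hlog : 0 < Real.log 2 := Real.log_pos one_lt_two
  have hy : - -(L * S) ≤ l * x + Real.log 2 := by nlinarith
  have key := sq_div_le_exp_sub_one_sub hM hy
  rw [Real.exp_add, Real.exp_log two_pos] at key
  calc a / (4 + 2 * -(L * S)) * (x + Real.log 2 / l) ^ 2
      ≤ l / (4 + 2 * -(L * S)) * (x + Real.log 2 / l) ^ 2 := by gcongr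
    _ = (1 / l) * ((l * x + Real.log 2) ^ 2 / (4 + 2 * -(L * S))) := by
        have hne : 4 + 2 * -(L * S) ≠ 0 := by positivity
        generalize 4 + 2 * -(L * S) = D at hne ⊢
        field_simp
    _ ≤ (1 / l) * (Real.exp (l * x) * 2 - 1 - (l * x + Real.log 2)) := by gcongr
    _ = (1 / l) * (2 * Real.exp (l * x) - 1) - x - Real.log 2 / l := by
        field_simp
        ring
end

section
/- Let a < b be real numbers and define q : [a,b] → ℝ by q(x) := 30·(x-a)²·(b-x)²/(b-a)⁵. Then q is a probability density on [a,b], i.e. ∫_a^b q(x) dx = 1, and its Fisher information satisfies ∫_a^b (q'(x))²/q(x) dx = 40/(b-a)². -/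
open Real Set

theorem hasDerivAt_rescaledBeta (a b x : ℝ) :
    HasDerivAt (fun x => 30 * (x - a) ^ 2 * (b - x) ^ 2 / (b - a) ^ 5)
      (60 * (x - a) * (b - x) * (a + b - 2 * x) / (b - a) ^ 5) x := by
  have ha : HasDerivAt (fun x : ℝ => x - a) 1 x := (hasDerivAt_id x).sub_const a
  have hb : HasDerivAt (fun x : ℝ => b - x) (-1) x := (hasDerivAt_id x).const_sub b
  refine ((((ha.fun_pow 2).const_mul 30).fun_mul (hb.fun_pow 2)).div_const _).congr_deriv ?_
  push_cast
  ring

theorem integral_rescaledBeta {a b : ℝ} (hab : a < b) :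
    (∫ x in a..b, 30 * (x - a) ^ 2 * (b - x) ^ 2 / (b - a) ^ 5) = 1 := by
  have hne : b - a ≠ 0 := (sub_pos.2 hab).ne'
  have hderiv (x : ℝ) : HasDerivAt
      (fun x => (10 * (b - a) ^ 2 * (x - a) ^ 3 - 15 * (b - a) * (x - a) ^ 4
        + 6 * (x - a) ^ 5) / (b - a) ^ 5)
      (30 * (x - a) ^ 2 * (b - x) ^ 2 / (b - a) ^ 5) x := by
    have ha : HasDerivAt (fun x : ℝ => x - a) 1 x := (hasDerivAt_id x).sub_const a
    refine (((((ha.fun_pow 3).const_mul _).fun_sub ((ha.fun_pow 4).const_mul _)).fun_add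
      ((ha.fun_pow 5).const_mul _)).div_const _).congr_deriv ?_
    push_cast
    ring
  rw [intervalIntegral.integral_eq_sub_of_hasDerivAt (fun x _ => hderiv x)
    (Continuous.intervalIntegrable (by fun_prop) _ _)]
  field_simp
  ring

theorem integral_sq_deriv_div_rescaledBeta {a b : ℝ} (hab : a < b) :
    (∫ x in a..b,
        (deriv (fun x => 30 * (x - a) ^ 2 * (b - x) ^ 2 / (b - a) ^ 5) x) ^ 2 /
          (30 * (x - a) ^ 2 * (b - x) ^ 2 / (b - a) ^ 5)) = 40 / (b - a) ^ 2 := by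
  have hne : b - a ≠ 0 := (sub_pos.2 hab).ne'
  have hderiv (x : ℝ) : HasDerivAt (fun x => -20 * (a + b - 2 * x) ^ 3 / (b - a) ^ 5)
      (120 * (a + b - 2 * x) ^ 2 / (b - a) ^ 5) x := by
    have hm : HasDerivAt (fun x : ℝ => a + b - 2 * x) (-(2 * 1)) x :=
      ((hasDerivAt_id x).const_mul 2).const_sub _
    refine (((hm.fun_pow 3).const_mul _).div_const _).congr_deriv ?_
    push_cast
    ring
  have hcongr : (∫ x in a..b,
        (deriv (fun x => 30 * (x - a) ^ 2 * (b - x) ^ 2 / (b - a) ^ 5) x) ^ 2 /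
          (30 * (x - a) ^ 2 * (b - x) ^ 2 / (b - a) ^ 5)) =
      ∫ x in a..b, 120 * (a + b - 2 * x) ^ 2 / (b - a) ^ 5 := by
    refine intervalIntegral.integral_congr_Ioo_of_le hab.le fun x hx => ?_
    have hxa : x - a ≠ 0 := (sub_pos.2 hx.1).ne'
    have hxb : b - x ≠ 0 := (sub_pos.2 hx.2).ne'
    simp only [(hasDerivAt_rescaledBeta a b x).deriv]
    field_simp
    ring
  rw [hcongr, intervalIntegral.integral_eq_sub_of_hasDerivAt (fun x _ => hderiv x)
    (Continuous.intervalIntegrable (by fun_prop) _ _)]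
  field_simp
  ring

theorem stmt_15 (a b : ℝ) (hab : a < b) :
    (∫ x in a..b, 30 * (x - a) ^ 2 * (b - x) ^ 2 / (b - a) ^ 5) = 1 ∧
    (∫ x in a..b,
        (deriv (fun x => 30 * (x - a) ^ 2 * (b - x) ^ 2 / (b - a) ^ 5) x) ^ 2 /
          (30 * (x - a) ^ 2 * (b - x) ^ 2 / (b - a) ^ 5)) = 40 / (b - a) ^ 2 := by
  exact ⟨integral_rescaledBeta hab, integral_sq_deriv_div_rescaledBeta hab⟩
end

section
/- Let 0 < a < b and let n ≥ 1 be a natural number. For λ ∈ [a,b] let P_λ^{⊗n} denote the n-fold product of the Poisson distribution with parameter λ on ℕⁿ. Then for every measurable function λ̂ : ℕⁿ → ℝ, sup_{λ ∈ [a,b]} ∫_{ℕⁿ} (λ̂(x) - λ)² dP_λ^{⊗n}(x) ≥ 1/(40/(b-a)² + n/a). -/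
open MeasureTheory ProbabilityTheory
open scoped ENNReal
open scoped NNReal

lemma hasSum_poissonMeasure_id (r : ℝ≥0) :
    HasSum (fun k : ℕ => Real.exp (-r) * r ^ k / k.factorial * (k : ℝ)) r := by
  rw [← hasSum_nat_add_iff' 1]
  convert! (hasSum_one_poissonMeasure r).mul_left (r : ℝ) using 1
  · ext k
    rw [Nat.factorial_succ]
    push_cast
    field_simp
    ring
  · simp

lemma hasSum_poissonMeasure_sq (r : ℝ≥0) :
    HasSum (fun k : ℕ => Real.exp (-r) * r ^ k / k.factorial * (k : ℝ) ^ 2) (r ^ 2 + r) := by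
  have h : HasSum (fun k : ℕ => Real.exp (-r) * r ^ k / k.factorial * ((k : ℝ) * (k - 1)))
      ((r : ℝ) ^ 2) := by
    rw [← hasSum_nat_add_iff' 2]
    convert! (hasSum_one_poissonMeasure r).mul_left ((r : ℝ) ^ 2) using 1
    · ext k
      rw [Nat.factorial_succ, Nat.factorial_succ]
      push_cast
      field_simp
      ring
    · simp [Finset.sum_range_succ]
  convert! h.add (hasSum_poissonMeasure_id r) using 1
  ext k
  ring

lemma memLp_two_poissonMeasure (r : ℝ≥0) :
    MemLp (fun k : ℕ => (k : ℝ)) 2 (poissonMeasure r) := by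
  rw [memLp_two_iff_integrable_sq .of_discrete, integrable_poissonMeasure_iff]
  simpa using (hasSum_poissonMeasure_sq r).summable

lemma integral_id_poissonMeasure (r : ℝ≥0) : ∫ k : ℕ, (k : ℝ) ∂poissonMeasure r = r := by
  rw [integral_poissonMeasure]
  exact (hasSum_poissonMeasure_id r).tsum_eq

lemma variance_poissonMeasure (r : ℝ≥0) :
    Var[fun k : ℕ => (k : ℝ); poissonMeasure r] = r := by
  rw [variance_eq_sub (memLp_two_poissonMeasure r), integral_id_poissonMeasure,
    integral_poissonMeasure]
  simp [(hasSum_poissonMeasure_sq r).tsum_eq]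

/-- The second moment of an affine function of the score of a Poisson sample. -/
lemma lintegral_affine_sq_pi_poissonMeasure {ι : Type*} [Fintype ι] {r : ℝ} (hr : 0 < r)
    (A B : ℝ) :
    ∫⁻ x, ENNReal.ofReal ((A + B * ((∑ i, (x i : ℝ)) / r - Fintype.card ι)) ^ 2)
      ∂(Measure.pi fun _ : ι => poissonMeasure r.toNNReal) =
    ENNReal.ofReal (A ^ 2 + B ^ 2 * (Fintype.card ι / r)) := by
  set μ := Measure.pi fun _ : ι => poissonMeasure r.toNNReal
  have hcoe : (r.toNNReal : ℝ) = r := Real.coe_toNNReal _ hr.le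
  have hi (i : ι) : MemLp (fun x : ι → ℕ => (x i : ℝ)) 2 μ :=
    (memLp_two_poissonMeasure r.toNNReal).comp_measurePreserving
      (measurePreserving_eval (fun _ : ι => poissonMeasure r.toNNReal) i)
  have hS : MemLp (fun x : ι → ℕ => ∑ i, (x i : ℝ)) 2 μ := memLp_finsetSum _ fun i _ => hi i
  have hmean : ∫ x, ∑ i, (x i : ℝ) ∂μ = Fintype.card ι * r := by
    rw [integral_finsetSum _ fun i _ => (hi i).integrable one_le_two]
    have (i : ι) : ∫ x : ι → ℕ, (x i : ℝ) ∂μ = r := by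
      rw [integral_comp_eval (μ := fun _ : ι => poissonMeasure r.toNNReal)
        (f := fun k : ℕ => (k : ℝ)) .of_discrete, integral_id_poissonMeasure, hcoe]
    simp [this]
  have hvar : Var[fun x : ι → ℕ => ∑ i, (x i : ℝ); μ] = Fintype.card ι * r := by
    have := variance_sum_pi (μ := fun _ : ι => poissonMeasure r.toNNReal)
      fun _ => memLp_two_poissonMeasure r.toNNReal
    simp only [variance_poissonMeasure, hcoe, Finset.sum_const, Finset.card_univ,
      nsmul_eq_mul] at this
    rw [← this]
    congr 1
    ext x
    simp
  have hcent : ∫ x, (∑ i, (x i : ℝ) - Fintype.card ι * r) ^ 2 ∂μ = Fintype.card ι * r := by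
    rw [variance_eq_integral hS.aemeasurable, hmean] at hvar
    exact hvar
  have hY : MemLp (fun x : ι → ℕ => ∑ i, (x i : ℝ) - Fintype.card ι * r) 2 μ :=
    hS.sub (memLp_const _)
  have hY0 : ∫ x, (∑ i, (x i : ℝ) - Fintype.card ι * r) ∂μ = 0 := by
    rw [integral_sub (hS.integrable one_le_two) (integrable_const _), hmean]
    simp
  have heq : (fun x : ι → ℕ => (A + B * ((∑ i, (x i : ℝ)) / r - Fintype.card ι)) ^ 2) =
      fun x => A ^ 2 + 2 * A * B / r * (∑ i, (x i : ℝ) - Fintype.card ι * r) +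
        B ^ 2 / r ^ 2 * (∑ i, (x i : ℝ) - Fintype.card ι * r) ^ 2 := by
    ext x
    field_simp
    ring
  have hint1 : Integrable (fun x : ι → ℕ => A ^ 2 + 2 * A * B / r *
      (∑ i, (x i : ℝ) - Fintype.card ι * r)) μ :=
    (integrable_const _).add ((hY.integrable one_le_two).const_mul _)
  have hint2 := hY.integrable_sq.const_mul (B ^ 2 / r ^ 2)
  rw [← ofReal_integral_eq_lintegral_ofReal (by rw [heq]; exact hint1.add hint2)
    (.of_forall fun _ => sq_nonneg _), heq, integral_add hint1 hint2,
    integral_add (integrable_const _) ((hY.integrable one_le_two).const_mul _),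
    integral_const_mul, integral_const_mul, hcent, hY0]
  congr 1
  simp
  field_simp

lemma pi_poissonMeasure_singleton {ι : Type*} [Fintype ι] {r : ℝ} (hr : 0 ≤ r) (x : ι → ℕ) :
    (Measure.pi fun _ : ι => poissonMeasure r.toNNReal) {x} =
      ENNReal.ofReal (Real.exp (-(Fintype.card ι * r)) * r ^ (∑ i, x i) /
        ∏ i, ((x i).factorial : ℝ)) := by
  simp only [Measure.pi_singleton, poissonMeasure_singleton, Real.coe_toNNReal _ hr]
  rw [← ENNReal.ofReal_prod_of_nonneg fun _ _ => by positivity, Finset.prod_div_distrib,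
    Finset.prod_mul_distrib, Finset.prod_pow_eq_pow_sum, Finset.prod_const, ← Real.exp_nat_mul,
    Finset.card_univ, mul_neg]

/-- The van Trees inequality for a single observation, with prior density `g ^ 2`, likelihood `p`,
score `u`, and the Cauchy-Schwarz step replaced by its linearization with parameter `c`. -/
lemma van_trees_lintegral_le {a b c : ℝ} (hab : a ≤ b) (hc : 0 ≤ c) (e : ℝ)
    {g g' p u : ℝ → ℝ} (hga : g a = 0) (hgb : g b = 0)
    (hg : ∀ l ∈ Set.Icc a b, HasDerivAt g (g' l) l) (hg' : ContinuousOn g' (Set.Icc a b))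
    (hp : ∀ l ∈ Set.Icc a b, HasDerivAt p (u l * p l) l) (hu : ContinuousOn u (Set.Icc a b))
    (hp0 : ∀ l ∈ Set.Icc a b, 0 ≤ p l) :
    ∫⁻ l in Set.Icc a b, ENNReal.ofReal (2 * c * g l ^ 2 * p l) ≤
      ∫⁻ l in Set.Icc a b, ENNReal.ofReal
        (((e - l) ^ 2 * g l ^ 2 + c ^ 2 * (2 * g' l + g l * u l) ^ 2) * p l) := by
  have hgc : ContinuousOn g (Set.Icc a b) := fun l hl =>
    (hg l hl).continuousAt.continuousWithinAt
  have hpc : ContinuousOn p (Set.Icc a b) := fun l hl =>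
    (hp l hl).continuousAt.continuousWithinAt
  have hF : ∫ l in a..b, (-g l ^ 2 + (e - l) * g l * (2 * g' l + g l * u l)) * p l = 0 := by
    rw [intervalIntegral.integral_eq_sub_of_hasDerivAt
      (f := fun l => (e - l) * g l ^ 2 * p l)]
    · simp [hga, hgb]
    · intro l hl
      rw [Set.uIcc_of_le hab] at hl
      convert! ((((hasDerivAt_id l).const_sub e).mul ((hg l hl).pow 2)).mul (hp l hl)) using 1
      simp
      ring
    · apply ContinuousOn.intervalIntegrable
      rw [Set.uIcc_of_le hab]
      fun_prop
  rw [intervalIntegral.integral_of_le hab, ← integral_Icc_eq_integral_Ioc] at hF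
  have hP : IntegrableOn (fun l => 2 * c * g l ^ 2 * p l) (Set.Icc a b) :=
    ContinuousOn.integrableOn_Icc (by fun_prop)
  have hQ : IntegrableOn (fun l => ((e - l) ^ 2 * g l ^ 2 +
      c ^ 2 * (2 * g' l + g l * u l) ^ 2) * p l) (Set.Icc a b) :=
    ContinuousOn.integrableOn_Icc (by fun_prop)
  have hD : IntegrableOn (fun l => (-g l ^ 2 + (e - l) * g l * (2 * g' l + g l * u l)) * p l)
      (Set.Icc a b) := ContinuousOn.integrableOn_Icc (by fun_prop)
  rw [← ofReal_integral_eq_lintegral_ofReal hP, ← ofReal_integral_eq_lintegral_ofReal hQ]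
  · apply ENNReal.ofReal_le_ofReal
    rw [← sub_nonpos, ← integral_sub hP hQ]
    calc _ ≤ ∫ l in Set.Icc a b,
          -(2 * c) * ((-g l ^ 2 + (e - l) * g l * (2 * g' l + g l * u l)) * p l) := by
          refine setIntegral_mono_on (hP.sub hQ) (hD.const_mul _) measurableSet_Icc
            fun l hl => ?_
          have := mul_nonneg (sq_nonneg ((e - l) * g l - c * (2 * g' l + g l * u l))) (hp0 l hl)
          linarith
      _ = 0 := by rw [integral_const_mul, hF, mul_zero]
  · filter_upwards [ae_restrict_mem measurableSet_Icc] with l hl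
    have := hp0 l hl
    simp only [Pi.zero_apply]
    positivity
  · filter_upwards [ae_restrict_mem measurableSet_Icc] with l hl
    have := hp0 l hl
    simp only [Pi.zero_apply]
    positivity

/-- The likelihood of a Poisson sample has logarithmic derivative `s / l - n`. -/
lemma hasDerivAt_exp_neg_mul_mul_pow {l : ℝ} (hl : l ≠ 0) (n C : ℝ) (s : ℕ) :
    HasDerivAt (fun l => Real.exp (-(n * l)) * l ^ s / C)
      ((s / l - n) * (Real.exp (-(n * l)) * l ^ s / C)) l := by
  convert! ((((hasDerivAt_id l).const_mul n).neg.exp).mul (hasDerivAt_pow s l)).div_const C using 1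
  rcases s with _ | s
  · simp
    ring
  · simp only [Nat.add_sub_cancel, pow_succ, id, Pi.neg_apply]
    field_simp
    ring

/-- The linearized van Trees inequality for a Poisson sample and the prior density `g ^ 2`. -/
lemma van_trees_pi_poissonMeasure {ι : Type*} [Fintype ι] {a b c : ℝ} (ha : 0 < a)
    (hab : a ≤ b) (hc : 0 ≤ c) (est : (ι → ℕ) → ℝ) {g g' : ℝ → ℝ} (hga : g a = 0)
    (hgb : g b = 0) (hg : ∀ l, HasDerivAt g (g' l) l) (hg' : Continuous g') :
    ∫⁻ l in Set.Icc a b, ENNReal.ofReal (2 * c * g l ^ 2) ≤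
      ∫⁻ l in Set.Icc a b, (ENNReal.ofReal (g l ^ 2) *
        (∫⁻ x, ENNReal.ofReal ((est x - l) ^ 2)
          ∂(Measure.pi fun _ : ι => poissonMeasure l.toNNReal)) +
        ENNReal.ofReal (c ^ 2 * ((2 * g' l) ^ 2 + g l ^ 2 * (Fintype.card ι / l)))) := by
  have hgc : Continuous g := continuous_iff_continuousAt.2 fun l => (hg l).continuousAt
  have hgm := hgc.measurable
  have hgm' := hg'.measurable
  set p : (ι → ℕ) → ℝ → ℝ := fun x l => Real.exp (-(Fintype.card ι * l)) * l ^ (∑ i, x i) /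
    ∏ i, ((x i).factorial : ℝ)
  set u : (ι → ℕ) → ℝ → ℝ := fun x l => (∑ i, (x i : ℝ)) / l - Fintype.card ι
  have hp (x : ι → ℕ) (l : ℝ) (hl : l ∈ Set.Icc a b) :
      (Measure.pi fun _ : ι => poissonMeasure l.toNNReal) {x} = ENNReal.ofReal (p x l) :=
    pi_poissonMeasure_singleton (ha.le.trans hl.1) x
  have hp0 (x : ι → ℕ) (l : ℝ) (hl : l ∈ Set.Icc a b) : 0 ≤ p x l := by
    have : 0 ≤ l := ha.le.trans hl.1
    positivity
  have hpm (x : ι → ℕ) : Measurable (p x) := by fun_prop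
  have hum (x : ι → ℕ) : Measurable (u x) := by fun_prop
  calc ∫⁻ l in Set.Icc a b, ENNReal.ofReal (2 * c * g l ^ 2)
      = ∫⁻ l in Set.Icc a b, ∑' x, ENNReal.ofReal (2 * c * g l ^ 2 * p x l) := by
        refine setLIntegral_congr_fun measurableSet_Icc fun l hl => ?_
        have : ENNReal.ofReal (2 * c * g l ^ 2) = ∫⁻ _, ENNReal.ofReal (2 * c * g l ^ 2)
            ∂(Measure.pi fun _ : ι => poissonMeasure l.toNNReal) := by simp
        rw [this, lintegral_countable']
        refine tsum_congr fun x => ?_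
        rw [hp x l hl, ENNReal.ofReal_mul (p := 2 * c * g l ^ 2) (by positivity)]
    _ = ∑' x, ∫⁻ l in Set.Icc a b, ENNReal.ofReal (2 * c * g l ^ 2 * p x l) :=
        lintegral_tsum fun x => by fun_prop
    _ ≤ ∑' x, ∫⁻ l in Set.Icc a b, ENNReal.ofReal
          (((est x - l) ^ 2 * g l ^ 2 + c ^ 2 * (2 * g' l + g l * u x l) ^ 2) * p x l) := by
        refine ENNReal.tsum_le_tsum fun x => van_trees_lintegral_le hab hc (est x) hga hgb
          (fun l _ => hg l) hg'.continuousOn (fun l hl => ?_) ?_ (hp0 x)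
        · have := hasDerivAt_exp_neg_mul_mul_pow (ha.trans_le hl.1).ne' (Fintype.card ι)
            (∏ i, ((x i).factorial : ℝ)) (∑ i, x i)
          push_cast at this
          exact this
        · exact (continuousOn_const.div continuousOn_id fun l hl =>
            (ha.trans_le hl.1).ne').sub continuousOn_const
    _ = ∫⁻ l in Set.Icc a b, ∑' x, ENNReal.ofReal
          (((est x - l) ^ 2 * g l ^ 2 + c ^ 2 * (2 * g' l + g l * u x l) ^ 2) * p x l) :=
        (lintegral_tsum fun x => by fun_prop).symm
    _ = _ := by
        refine setLIntegral_congr_fun measurableSet_Icc fun l hl => ?_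
        rw [ENNReal.ofReal_mul (sq_nonneg c), ← lintegral_affine_sq_pi_poissonMeasure
          (ha.trans_le hl.1), ← lintegral_const_mul _ .of_discrete,
          ← lintegral_const_mul _ .of_discrete, ← lintegral_add_left .of_discrete,
          lintegral_countable']
        refine tsum_congr fun x => ?_
        rw [hp x l hl, ENNReal.ofReal_mul (by positivity),
          ENNReal.ofReal_add (by positivity) (by positivity), mul_comm ((est x - l) ^ 2),
          ENNReal.ofReal_mul (by positivity), ENNReal.ofReal_mul (by positivity)]

theorem stmt_17 (a b : ℝ) (ha : 0 < a) (hab : a < b) (n : ℕ) (hn : 1 ≤ n)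
    (est : (Fin n → ℕ) → ℝ) (hmeas : Measurable est) :
    ENNReal.ofReal (1 / (40 / (b - a) ^ 2 + n / a)) ≤
      ⨆ l ∈ Set.Icc a b,
        ∫⁻ x, ENNReal.ofReal ((est x - l) ^ 2)
          ∂(Measure.pi fun _ : Fin n => poissonMeasure (Real.toNNReal l)) := by
  set R := ⨆ l ∈ Set.Icc a b, ∫⁻ x, ENNReal.ofReal ((est x - l) ^ 2)
    ∂(Measure.pi fun _ : Fin n => poissonMeasure (Real.toNNReal l))
  set J := 40 / (b - a) ^ 2 + n / a
  have hba : 0 < b - a := sub_pos.2 hab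
  have hJ0 : 0 < J := by positivity
  set g : ℝ → ℝ := fun l => (l - a) * (b - l) with hgdef
  set g' : ℝ → ℝ := fun l => a + b - 2 * l with hgdef'
  set N := (b - a) ^ 5 / 30 with hN
  have hN0 : 0 < N := by positivity
  have hg (l : ℝ) : HasDerivAt g (g' l) l := by
    convert! ((hasDerivAt_id l).sub_const a).mul ((hasDerivAt_id l).const_sub b) using 1
    simp [hgdef']
    ring
  have hgc : Continuous g := by fun_prop
  have hgc' : Continuous g' := by fun_prop
  have hg2 : ∫ l in Set.Icc a b, g l ^ 2 = N := by
    rw [integral_Icc_eq_integral_Ioc, ← intervalIntegral.integral_of_le hab.le,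
      intervalIntegral.integral_eq_sub_of_hasDerivAt (f := fun l =>
        (b - a) ^ 2 * (l - a) ^ 3 / 3 - (b - a) * (l - a) ^ 4 / 2 + (l - a) ^ 5 / 5)]
    · simp only [hN]
      ring
    · intro l _
      have h := (hasDerivAt_id l).sub_const a
      convert! ((((h.pow 3).const_mul ((b - a) ^ 2)).div_const 3).sub
        (((h.pow 4).const_mul (b - a)).div_const 2)).add ((h.pow 5).div_const 5) using 1
      simp [hgdef]
      ring
    · exact Continuous.intervalIntegrable (by fun_prop) _ _
  have hg2' : ∫ l in Set.Icc a b, (2 * g' l) ^ 2 = N * (40 / (b - a) ^ 2) := by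
    rw [integral_Icc_eq_integral_Ioc, ← intervalIntegral.integral_of_le hab.le,
      intervalIntegral.integral_eq_sub_of_hasDerivAt (f := fun l =>
        -(2 / 3) * (a + b - 2 * l) ^ 3)]
    · simp only [hN]
      field_simp
      ring
    · intro l _
      convert! ((((hasDerivAt_id l).const_mul 2).const_sub (a + b)).pow 3).const_mul
        (-(2 / 3) : ℝ) using 1
      simp [hgdef']
      ring
    · exact Continuous.intervalIntegrable (by fun_prop) _ _
  have hi1 : IntegrableOn (fun l => g l ^ 2) (Set.Icc a b) :=
    Continuous.integrableOn_Icc (by fun_prop)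
  have hi2 : IntegrableOn (fun l => (2 * g' l) ^ 2) (Set.Icc a b) :=
    Continuous.integrableOn_Icc (by fun_prop)
  have key : ENNReal.ofReal (2 * J⁻¹ * N) ≤
      ENNReal.ofReal N * R + ENNReal.ofReal (J⁻¹ ^ 2 * (N * J)) := by
    calc ENNReal.ofReal (2 * J⁻¹ * N)
        = ∫⁻ l in Set.Icc a b, ENNReal.ofReal (2 * J⁻¹ * g l ^ 2) := by
          rw [← hg2, ← integral_const_mul, ofReal_integral_eq_lintegral_ofReal
            (hi1.const_mul _) (.of_forall fun _ => by positivity)]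
      _ ≤ _ := van_trees_pi_poissonMeasure ha hab.le (by positivity) est (by simp [hgdef])
          (by simp [hgdef]) hg hgc'
      _ ≤ ∫⁻ l in Set.Icc a b, (ENNReal.ofReal (g l ^ 2) * R +
            ENNReal.ofReal (J⁻¹ ^ 2 * ((2 * g' l) ^ 2 + g l ^ 2 * (n / a)))) := by
          refine setLIntegral_mono' measurableSet_Icc fun l hl => ?_
          rw [Fintype.card_fin]
          gcongr
          · exact le_iSup₂_of_le l hl le_rfl
          · exact hl.1
      _ = _ := by
          have hi : IntegrableOn (fun l => J⁻¹ ^ 2 * ((2 * g' l) ^ 2 + g l ^ 2 * (n / a)))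
              (Set.Icc a b) := (hi2.add (hi1.mul_const _)).const_mul _
          rw [lintegral_add_left (by fun_prop), lintegral_mul_const _ (by fun_prop),
            ← ofReal_integral_eq_lintegral_ofReal hi1 (.of_forall fun _ => sq_nonneg _), hg2,
            ← ofReal_integral_eq_lintegral_ofReal hi
              (.of_forall fun _ => by positivity), integral_const_mul,
            integral_add hi2 (hi1.mul_const _), integral_mul_const, hg2, hg2', ← mul_add]
  rcases eq_or_ne R ⊤ with h | h
  · simp [h]
  rw [← ENNReal.ofReal_toReal h, ← ENNReal.ofReal_mul hN0.le,
    ← ENNReal.ofReal_add (by positivity) (by positivity),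
    ENNReal.ofReal_le_ofReal_iff (by positivity)] at key
  rw [← ENNReal.ofReal_toReal h]
  apply ENNReal.ofReal_le_ofReal
  have hJJ : J⁻¹ ^ 2 * (N * J) = J⁻¹ * N := by field_simp
  rw [hJJ] at key
  rw [one_div]
  exact le_of_mul_le_mul_left (by linarith) hN0
end
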